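/- arXiv:1706.00565 — 2 statements merged into one kernel-verified Lean document; each statement's English description precedes it below -/
import Mathlib

section
/- Let 𝓐 = (A_0, A_1, 𝓕) be a two-phylum algebra with 𝓕 = 𝓖_0 ∪ 𝓖_1 ∪ {h}, where 𝓖_0 consists of operations on A_0 alone, 𝓖_1 consists of operations on A_1 alone, h : A_1 → A_0, 𝓖_0 and 𝓖_1 have the same signature, and h is a homomorphism from (A_1, 𝓖_1) into (A_0, 𝓖_0). Suppose 𝓐_0 = (A_0, 𝓖_0) is not a Ramsey algebra, and that there exist a sequence β⃗ ∈ ^ω(im h) and a set X ⊆ A_0 witnessing this failure (i.e. no reduction u⃗ ≤_{𝓖_0} β⃗ satisfies FR_{𝓖_0}(u⃗) ⊆ X or FR_{𝓖_0}(u⃗) ∩ X = ∅). Then 𝓐 is not an e⃗-Ramsey algebra for any e⃗ ∈ Ω_0. -/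
universe u v

/-- A (heterogeneous) operation: a list of input sorts, an output sort, and an
underlying function on lists of elements (only its values on lists of the right
length and sorts matter). -/
structure HetOp (I : Type u) (U : Type v) where
  inSorts : List I
  outSort : I
  fn : List U → U

namespace HetRamsey

variable {I : Type u} {U : Type v}

/-- `f` maps the phyla prescribed by its input sorts into the phylum of its output sort. -/
def WellSorted (A : I → Set U) (f : HetOp I U) : Prop :=
  ∀ xs : List U, List.Forall₂ (fun x ξ => x ∈ A ξ) xs f.inSorts → f.fn xs ∈ A f.outSort

/-- Apply the operations in `hs` to consecutive chunks of the list `xs`. -/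
def applyChunks : List (HetOp I U) → List U → List U
  | [], _ => []
  | h :: t, xs => h.fn (xs.take h.inSorts.length) :: applyChunks t (xs.drop h.inSorts.length)

/-- The orderly terms over a family `F` of operations: `F` itself, the identity
operations, closed under orderly composition. -/
inductive OT (F : Set (HetOp I U)) : HetOp I U → Prop
  | base {f : HetOp I U} : f ∈ F → OT F f
  | id (ξ : I) (c : HetOp I U) :
      c.inSorts = [ξ] → c.outSort = ξ → (∀ x : U, c.fn [x] = x) → OT F c
  | comp (g : HetOp I U) (hs : List (HetOp I U)) :
      g ∈ F → (∀ h ∈ hs, OT F h) →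
      List.Forall₂ (fun (h : HetOp I U) ξ => h.outSort = ξ) hs g.inSorts →
      OT F ⟨(hs.map HetOp.inSorts).flatten, g.outSort, fun xs => g.fn (applyChunks hs xs)⟩

/-- `b` is `e`-sorted: the `i`-th term lies in phylum `A (e i)`. -/
def Sorted (A : I → Set U) (e : ℕ → I) (b : ℕ → U) : Prop :=
  ∀ i, b i ∈ A (e i)

/-- `a` is a reduction of `b` with respect to the family of operations `F`:
each term `a j` is obtained by applying an orderly term over `F` to a finite
subsequence of `b`, and these finite subsequences concatenate to a
subsequence of `b`. -/
def Reduction (A : I → Set U) (F : Set (HetOp I U)) (a b : ℕ → U) : Prop :=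
  ∃ (φ : ℕ → List ℕ) (f : ℕ → HetOp I U),
    (∀ j, OT F (f j)) ∧
    (∀ j, (φ j).Chain' (· < ·)) ∧
    (∀ j k, j < k → ∀ x ∈ φ j, ∀ y ∈ φ k, x < y) ∧
    (∀ j, List.Forall₂ (fun i ξ => b i ∈ A ξ) (φ j) (f j).inSorts) ∧
    (∀ j, a j = (f j).fn ((φ j).map b))

/-- `FR^e_F(b)`: the set of first terms of `e`-sorted reductions of `b`. -/
def FR (A : I → Set U) (F : Set (HetOp I U)) (e : ℕ → I) (b : ℕ → U) : Set U :=
  { x | ∃ a : ℕ → U, Reduction A F a b ∧ Sorted A e a ∧ a 0 = x }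

/-- The algebra with phyla `A` and operations `F` is an `e`-Ramsey algebra. -/
def IsERamsey (A : I → Set U) (F : Set (HetOp I U)) (e : ℕ → I) : Prop :=
  ∀ b : ℕ → U, Sorted A e b → ∀ X : Set U, X ⊆ A (e 0) →
    ∃ a : ℕ → U, Reduction A F a b ∧ Sorted A e a ∧
      (FR A F e a ⊆ X ∨ FR A F e a ∩ X = ∅)

/-- The homogeneous algebra `(A ξ, F)` is a Ramsey algebra: it is `e`-Ramsey for
the constant sort with value `ξ`. -/
def IsRamsey (A : I → Set U) (F : Set (HetOp I U)) (ξ : I) : Prop :=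
  IsERamsey A F fun _ => ξ

/-- For a homogeneous algebra: `FR_G(α) = { f(τ) : f ∈ OT(G), τ a finite subsequence of α }`. -/
def FRfin (A : I → Set U) (G : Set (HetOp I U)) (α : ℕ → U) : Set U :=
  { x | ∃ (f : HetOp I U) (ns : List ℕ), OT G f ∧ ns.Chain' (· < ·) ∧
      List.Forall₂ (fun i ξ => α i ∈ A ξ) ns f.inSorts ∧ x = f.fn (ns.map α) }

/-- `e ∈ Ω`: every value attained by the sort `e` is attained infinitely often. -/
def InOmega (e : ℕ → I) : Prop :=
  ∀ i, {j | e j = e i}.Infinite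

end HetRamsey

namespace HetRamsey

variable {I : Type u} {U : Type v}

/-- A representative of the identity operation on the phylum of index `ξ`. -/
def idOp (d : U) (ξ : I) : HetOp I U := ⟨[ξ], ξ, fun xs => xs.headD d⟩

theorem OT.of_idOp (F : Set (HetOp I U)) (d : U) (ξ : I) : OT F (idOp d ξ) :=
  OT.id ξ _ rfl rfl fun _ => rfl

theorem forall₂_outSort_iff {hs : List (HetOp I U)} {s : List I} :
    List.Forall₂ (fun (h : HetOp I U) ξ => h.outSort = ξ) hs s ↔ hs.map HetOp.outSort = s := by
  rw [← List.forall₂_map_left_iff (f := HetOp.outSort) (R := Eq), List.forall₂_eq_eq_eq]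

/-- A list sorted by a concatenation of sort lists splits accordingly. -/
theorem forall₂_take_drop_of_append {A : I → Set U} {xs : List U} {s t : List I}
    (h : List.Forall₂ (fun x ξ => x ∈ A ξ) xs (s ++ t)) :
    List.Forall₂ (fun x ξ => x ∈ A ξ) (xs.take s.length) s ∧
      List.Forall₂ (fun x ξ => x ∈ A ξ) (xs.drop s.length) t := by
  have h1 := List.forall₂_take s.length h
  have h2 := List.forall₂_drop s.length h
  rw [List.take_left] at h1
  rw [List.drop_left] at h2
  exact ⟨h1, h2⟩

theorem applyChunks_sorted {A : I → Set U} (hs : List (HetOp I U))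
    (hws : ∀ h ∈ hs, WellSorted A h) (xs : List U)
    (hxs : List.Forall₂ (fun x ξ => x ∈ A ξ) xs (hs.map HetOp.inSorts).flatten) :
    List.Forall₂ (fun x ξ => x ∈ A ξ) (applyChunks hs xs) (hs.map HetOp.outSort) := by
  induction hs generalizing xs with
  | nil => exact List.Forall₂.nil
  | cons h t ih =>
    rw [List.map_cons, List.flatten_cons] at hxs
    obtain ⟨h1, h2⟩ := forall₂_take_drop_of_append hxs
    exact List.Forall₂.cons (hws h (by simp) _ h1) (ih (fun k hk => hws k (by simp [hk])) _ h2)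

/-- Orderly terms over well-sorted operations are well-sorted. -/
theorem OT.wellSorted {A : I → Set U} {F : Set (HetOp I U)} (hF : ∀ f ∈ F, WellSorted A f)
    {f : HetOp I U} (hf : OT F f) : WellSorted A f := by
  induction hf with
  | base h => exact hF _ h
  | id ξ c hc1 hc2 hc3 =>
    intro xs hxs
    rw [hc1] at hxs
    obtain ⟨x, _, hx, hnil, rfl⟩ := List.forall₂_cons_right_iff.1 hxs
    obtain rfl := List.forall₂_nil_right_iff.1 hnil
    rwa [hc2, hc3]
  | comp g hs hg _ hout ih =>
    intro xs hxs
    refine hF g hg _ ?_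
    rw [← forall₂_outSort_iff.1 hout]
    exact applyChunks_sorted hs ih xs hxs

section Chunks

variable {A : I → Set U} {F F' : Set (HetOp I U)}

/-- If every member of `hs` is the image under `π` of a term over `F'`, the same holds for the
simultaneous application of `hs` to consecutive chunks. -/
theorem exists_applyChunks_map (π : U → U) (ξ₀ : I) (hs : List (HetOp I U))
    (H : ∀ h ∈ hs, ∃ k, OT F' k ∧ k.inSorts = h.inSorts.map (fun _ => ξ₀) ∧ k.outSort = ξ₀ ∧
      ∀ xs, List.Forall₂ (fun x ξ => x ∈ A ξ) xs h.inSorts → k.fn (xs.map π) = π (h.fn xs)) :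
    ∃ ks : List (HetOp I U), (∀ k ∈ ks, OT F' k) ∧
      (ks.map HetOp.inSorts).flatten = (hs.map HetOp.inSorts).flatten.map (fun _ => ξ₀) ∧
      ks.map HetOp.outSort = hs.map (fun _ => ξ₀) ∧
      ∀ xs, List.Forall₂ (fun x ξ => x ∈ A ξ) xs (hs.map HetOp.inSorts).flatten →
        applyChunks ks (xs.map π) = (applyChunks hs xs).map π := by
  induction hs with
  | nil => exact ⟨[], by simp, by simp, by simp, fun _ _ => rfl⟩
  | cons h t ih =>
    obtain ⟨k, hk, hkin, hkout, hkfn⟩ := H h (by simp)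
    obtain ⟨ks, hks, hksin, hksout, hksfn⟩ := ih fun h' hh' => H h' (by simp [hh'])
    refine ⟨k :: ks, ?_, ?_, ?_, ?_⟩
    · simpa using ⟨hk, hks⟩
    · rw [List.map_cons, List.flatten_cons, hkin, hksin]
      simp
    · rw [List.map_cons, hkout, hksout]
      simp
    · intro xs hxs
      rw [List.map_cons, List.flatten_cons] at hxs
      obtain ⟨h1, h2⟩ := forall₂_take_drop_of_append hxs
      have hlen : k.inSorts.length = h.inSorts.length := by rw [hkin, List.length_map]
      simp only [applyChunks, hlen, List.map_cons, ← List.map_take, ← List.map_drop,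
        hkfn _ h1, hksfn _ h2]

/-- If every member of `hs` can be precomposed with `π` on arguments of prescribed sorts, so can
the simultaneous application of `hs` to consecutive chunks. -/
theorem exists_applyChunks_comp (π : U → U) (hs : List (HetOp I U))
    (H : ∀ h ∈ hs, ∀ s : List I, s.length = h.inSorts.length →
      ∃ k, OT F k ∧ k.inSorts = s ∧ k.outSort = h.outSort ∧
        ∀ xs, List.Forall₂ (fun x ξ => x ∈ A ξ) xs s → k.fn xs = h.fn (xs.map π))
    (s : List I) (hs_len : s.length = (hs.map HetOp.inSorts).flatten.length) :
    ∃ ks : List (HetOp I U), (∀ k ∈ ks, OT F k) ∧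
      (ks.map HetOp.inSorts).flatten = s ∧
      ks.map HetOp.outSort = hs.map HetOp.outSort ∧
      ∀ xs, List.Forall₂ (fun x ξ => x ∈ A ξ) xs s →
        applyChunks ks xs = applyChunks hs (xs.map π) := by
  induction hs generalizing s with
  | nil =>
    have : s = [] := by simpa using hs_len
    subst this
    exact ⟨[], by simp, by simp, by simp, fun _ _ => rfl⟩
  | cons h t ih =>
    rw [List.map_cons, List.flatten_cons, List.length_append] at hs_len
    have hlen : (s.take h.inSorts.length).length = h.inSorts.length := by
      rw [List.length_take]; omega
    obtain ⟨k, hk, hkin, hkout, hkfn⟩ := H h (by simp) _ hlen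
    obtain ⟨ks, hks, hksin, hksout, hksfn⟩ := ih (fun h' hh' => H h' (by simp [hh']))
      (s.drop h.inSorts.length) (by rw [List.length_drop]; omega)
    refine ⟨k :: ks, ?_, ?_, ?_, ?_⟩
    · simpa using ⟨hk, hks⟩
    · rw [List.map_cons, List.flatten_cons, hkin, hksin, List.take_append_drop]
    · rw [List.map_cons, hkout, hksout, List.map_cons]
    · intro xs hxs
      rw [← List.take_append_drop h.inSorts.length s] at hxs
      obtain ⟨h1, h2⟩ := forall₂_take_drop_of_append hxs
      rw [hlen] at h1 h2
      simp only [applyChunks, hkin, hlen, ← List.map_take, ← List.map_drop,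
        hkfn _ h1, hksfn _ h2]

theorem applyChunks_map_unary (π : U → U) (leaf : I → HetOp I U)
    (hin : ∀ ξ, (leaf ξ).inSorts = [ξ]) (hfn : ∀ ξ, ∀ x ∈ A ξ, (leaf ξ).fn [x] = π x)
    {xs : List U} {s : List I} (hxs : List.Forall₂ (fun x ξ => x ∈ A ξ) xs s) :
    applyChunks (s.map leaf) xs = xs.map π := by
  induction hxs with
  | nil => rfl
  | cons hx _ ih => simp [applyChunks, hin, hfn _ _ hx, ih]

/-- Orderly terms may be precomposed, leaf by leaf, with unary orderly terms `leaf ξ` which all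
act as the single map `π`. -/
theorem OT.exists_comp_leaf {ξ₀ : I} (π : U → U) (leaf : I → HetOp I U)
    (hleaf : ∀ ξ, OT F (leaf ξ)) (hin : ∀ ξ, (leaf ξ).inSorts = [ξ])
    (hout : ∀ ξ, (leaf ξ).outSort = ξ₀) (hfn : ∀ ξ, ∀ x ∈ A ξ, (leaf ξ).fn [x] = π x)
    (hF' : F' ⊆ F) (hF'in : ∀ f ∈ F', ∀ ξ ∈ f.inSorts, ξ = ξ₀)
    {f : HetOp I U} (hf : OT F' f) (hfin : ∀ ξ ∈ f.inSorts, ξ = ξ₀) (s : List I)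
    (hlen : s.length = f.inSorts.length) :
    ∃ k, OT F k ∧ k.inSorts = s ∧ k.outSort = f.outSort ∧
      ∀ xs, List.Forall₂ (fun x ξ => x ∈ A ξ) xs s → k.fn xs = f.fn (xs.map π) := by
  induction hf generalizing s with
  | @base g hg =>
    refine ⟨_, OT.comp g (s.map leaf) (hF' hg) ?_ ?_, ?_, rfl, ?_⟩
    · simp only [List.mem_map]
      rintro _ ⟨ξ, _, rfl⟩
      exact hleaf ξ
    · rw [forall₂_outSort_iff, List.map_map, List.eq_replicate_iff.2 ⟨rfl, hF'in g hg⟩, ← hlen]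
      simp [Function.comp_def, hout]
    · simp only [List.map_map, Function.comp_def, hin]
      rw [← List.flatMap_def, List.flatMap_singleton']
    · intro xs hxs
      exact congrArg g.fn (applyChunks_map_unary π leaf hin hfn hxs)
  | id ξ c hc1 hc2 hc3 =>
    rw [hc1] at hlen hfin
    obtain ⟨η, rfl⟩ := List.length_eq_one_iff.1 hlen
    refine ⟨leaf η, hleaf η, hin η, ?_, ?_⟩
    · rw [hout, hc2, hfin ξ (by simp)]
    · intro xs hxs
      obtain ⟨x, _, hx, hnil, rfl⟩ := List.forall₂_cons_right_iff.1 hxs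
      obtain rfl := List.forall₂_nil_right_iff.1 hnil
      rw [hfn η x hx, List.map_singleton, hc3]
  | comp g hs hg _ hgout ih =>
    obtain ⟨ks, hks, hksin, hksout, hksfn⟩ := exists_applyChunks_comp (F := F) (A := A) π hs
      (fun h hh t ht => ih h hh (fun ξ hξ => hfin ξ (by
        simp only [List.mem_flatten, List.mem_map]
        exact ⟨_, ⟨h, hh, rfl⟩, hξ⟩)) t ht) s hlen
    refine ⟨_, OT.comp g ks (hF' hg) hks ?_, hksin, rfl, ?_⟩
    · rw [forall₂_outSort_iff, hksout, forall₂_outSort_iff.1 hgout]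
    · intro xs hxs
      exact congrArg g.fn (hksfn xs hxs)

end Chunks

/-- A value in `A (e 0)` of an orderly term on a finite subsequence of an `e`-sorted sequence is
the first term of an `e`-sorted reduction, provided `e ∈ Ω`. -/
theorem mem_FR_of_OT {A : I → Set U} {F : Set (HetOp I U)} {e : ℕ → I} (he : InOmega e)
    {a : ℕ → U} (ha : Sorted A e a) {f : HetOp I U} (hf : OT F f) {ns : List ℕ}
    (hns : ns.IsChain (· < ·)) (hsort : List.Forall₂ (fun i ξ => a i ∈ A ξ) ns f.inSorts)
    (hmem : f.fn (ns.map a) ∈ A (e 0)) : f.fn (ns.map a) ∈ FR A F e a := by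
  have hnext : ∀ N j, ∃ m, e m = e j ∧ N < m := fun N j => (he j).exists_gt N
  choose nxt hnxt hlt using hnext
  let M : ℕ → ℕ := fun j => Nat.rec (ns.foldr max 0) (fun j N => nxt N (j + 1)) j
  have hM : StrictMono M := strictMono_nat_of_lt_succ fun j => hlt _ _
  have hMe : ∀ j, e (M (j + 1)) = e (j + 1) := fun j => hnxt _ _
  have hM0 : ∀ x ∈ ns, x ≤ M 0 := by
    intro x hx
    change x ≤ ns.foldr max 0
    clear * - hx
    induction ns with
    | nil => simp at hx
    | cons y t ih =>
      rcases List.mem_cons.1 hx with rfl | h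
      · simp
      · exact (ih h).trans (by simp)
  let φ : ℕ → List ℕ := fun j => Nat.casesOn j ns fun j => [M (j + 1)]
  let t : ℕ → HetOp I U := fun j => Nat.casesOn j f fun j => idOp (a 0) (e (j + 1))
  refine ⟨fun j => (t j).fn ((φ j).map a), ⟨φ, t, ?_, ?_, ?_, ?_, fun _ => rfl⟩, ?_, rfl⟩
  · rintro (_ | j)
    · exact hf
    · exact OT.of_idOp _ _ _
  · rintro (_ | j)
    · exact hns
    · exact List.isChain_singleton _
  · rintro (_ | j) (_ | k) hjk x hx y hy
    · omega
    · obtain rfl : y = M (k + 1) := List.mem_singleton.1 hy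
      exact (hM0 x hx).trans_lt (hM (Nat.succ_pos k))
    · omega
    · obtain rfl : y = M (k + 1) := List.mem_singleton.1 hy
      obtain rfl : x = M (j + 1) := List.mem_singleton.1 hx
      exact hM hjk
  · rintro (_ | j)
    · exact hsort
    · refine List.Forall₂.cons ?_ List.Forall₂.nil
      rw [← hMe j]
      exact ha _
  · rintro (_ | j)
    · exact hmem
    · change a (M (j + 1)) ∈ A (e (j + 1))
      rw [← hMe j]
      exact ha _

/-- Terms of a two-phylum algebra project to terms over `G0`, erasing `hOp` and replacing the
operations `F ∈ G1` by `T F`. Here `π` is the identity on `A 0` and `hOp` on `A 1`. -/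
theorem OT.exists_projection {A : Fin 2 → Set U} {G0 G1 : Set (HetOp (Fin 2) U)}
    {hOp : HetOp (Fin 2) U} (d : U)
    (hG0 : ∀ f ∈ G0, f.outSort = 0 ∧ (∀ ξ ∈ f.inSorts, ξ = 0) ∧ WellSorted A f)
    (hG1 : ∀ f ∈ G1, f.outSort = 1 ∧ (∀ ξ ∈ f.inSorts, ξ = 1) ∧ WellSorted A f)
    (hin : hOp.inSorts = [1]) (hout : hOp.outSort = 0) (hws : WellSorted A hOp)
    {T : HetOp (Fin 2) U → HetOp (Fin 2) U} (hT : Set.MapsTo T G1 G0)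
    (hTarity : ∀ F ∈ G1, (T F).inSorts.length = F.inSorts.length)
    (hhom : ∀ F ∈ G1, ∀ xs : List U, List.Forall₂ (fun x ξ => x ∈ A ξ) xs F.inSorts →
      hOp.fn [F.fn xs] = (T F).fn (xs.map fun x => hOp.fn [x]))
    {π : U → U} (hπ0 : ∀ x ∈ A 0, π x = x) (hπ1 : ∀ x ∈ A 1, π x = hOp.fn [x])
    {f : HetOp (Fin 2) U} (hf : OT (G0 ∪ G1 ∪ {hOp}) f) :
    ∃ k, OT G0 k ∧ k.inSorts = f.inSorts.map (fun _ => 0) ∧ k.outSort = 0 ∧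
      ∀ xs, List.Forall₂ (fun x ξ => x ∈ A ξ) xs f.inSorts → k.fn (xs.map π) = π (f.fn xs) := by
  have hwsF : ∀ f ∈ G0 ∪ G1 ∪ {hOp}, WellSorted A f := by
    rintro f ((h | h) | rfl)
    exacts [(hG0 f h).2.2, (hG1 f h).2.2, hws]
  have hmap : ∀ {ρ : U → U} {ξ₀ : Fin 2}, (∀ x ∈ A ξ₀, π x = ρ x) → ∀ {xs : List U}
      {s : List (Fin 2)}, (∀ ξ ∈ s, ξ = ξ₀) → List.Forall₂ (fun x ξ => x ∈ A ξ) xs s →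
      xs.map π = xs.map ρ := by
    intro ρ ξ₀ hρ xs s hs hxs
    induction hxs with
    | nil => rfl
    | @cons x ξ _ _ hx _ ih =>
      obtain rfl := hs ξ (by simp)
      rw [List.map_cons, List.map_cons, hρ x hx, ih fun ξ hξ => hs ξ (by simp [hξ])]
  have hzero : ∀ g ∈ G0 ∪ G1, ∃ g' ∈ G0, g'.inSorts = g.inSorts.map (fun _ => 0) ∧
      ∀ xs, List.Forall₂ (fun x ξ => x ∈ A ξ) xs g.inSorts → g'.fn (xs.map π) = π (g.fn xs) := by
    rintro g (hg | hg)
    · obtain ⟨ho, hi, hw⟩ := hG0 g hg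
      refine ⟨g, hg, ?_, fun xs hxs => ?_⟩
      · rw [List.map_const']
        exact List.eq_replicate_iff.2 ⟨rfl, hi⟩
      · rw [hπ0 _ (ho ▸ hw xs hxs), hmap (ρ := fun x => x) hπ0 hi hxs, List.map_id']
    · obtain ⟨ho, hi, hw⟩ := hG1 g hg
      refine ⟨T g, hT hg, ?_, fun xs hxs => ?_⟩
      · rw [List.map_const', ← hTarity g hg]
        exact List.eq_replicate_iff.2 ⟨rfl, (hG0 _ (hT hg)).2.1⟩
      · rw [hπ1 _ (ho ▸ hw xs hxs), hhom g hg xs hxs, hmap hπ1 hi hxs]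
  induction hf with
  | @base g hg =>
    rcases hg with hg | rfl
    · obtain ⟨g', hg', hin', hfn'⟩ := hzero g hg
      exact ⟨g', OT.base hg', hin', (hG0 g' hg').1, hfn'⟩
    · refine ⟨idOp d 0, OT.of_idOp _ _ _, by rw [hin]; rfl, rfl, fun xs hxs => ?_⟩
      have hy := hws xs hxs
      rw [hout] at hy
      rw [hπ0 _ hy]
      rw [hin] at hxs
      obtain ⟨x, _, hx, hnil, rfl⟩ := List.forall₂_cons_right_iff.1 hxs
      obtain rfl := List.forall₂_nil_right_iff.1 hnil
      exact hπ1 x hx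
  | id ξ c hc1 hc2 hc3 =>
    refine ⟨idOp d 0, OT.of_idOp _ _ _, by rw [hc1]; rfl, rfl, fun xs hxs => ?_⟩
    rw [hc1] at hxs
    obtain ⟨x, _, hx, hnil, rfl⟩ := List.forall₂_cons_right_iff.1 hxs
    obtain rfl := List.forall₂_nil_right_iff.1 hnil
    rw [hc3]
    rfl
  | comp g hs hg hOT hgout ih =>
    have hgout' := forall₂_outSort_iff.1 hgout
    have hsorted := applyChunks_sorted hs fun h hh => (hOT h hh).wellSorted hwsF
    rcases hg with hg | rfl
    · obtain ⟨g', hg', hin', hfn'⟩ := hzero g hg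
      obtain ⟨ks, hks, hksin, hksout, hksfn⟩ := exists_applyChunks_map π 0 hs ih
      refine ⟨_, OT.comp g' ks hg' hks ?_, hksin, (hG0 g' hg').1, fun xs hxs => ?_⟩
      · rw [forall₂_outSort_iff, hksout, hin', ← hgout', List.map_map]
        rfl
      · change g'.fn (applyChunks ks (xs.map π)) = π (g.fn (applyChunks hs xs))
        rw [hksfn xs hxs, hfn' _ (hgout' ▸ hsorted xs hxs)]
    · rw [hin] at hgout'
      obtain ⟨t, rfl⟩ : ∃ t, hs = [t] := by
        rw [← List.length_eq_one_iff, ← List.length_map (f := HetOp.outSort), hgout']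
        rfl
      have ht : t.outSort = 1 := by simpa using hgout'
      obtain ⟨k, hk, hkin, hkout, hkfn⟩ := ih t (by simp)
      refine ⟨k, hk, by simpa using hkin, hkout, fun xs hxs => ?_⟩
      have hxs' : List.Forall₂ (fun x ξ => x ∈ A ξ) xs t.inSorts := by simpa using hxs
      have hmem := (hOT t (by simp)).wellSorted hwsF xs hxs'
      rw [ht] at hmem
      have hval : g.fn [t.fn xs] ∈ A 0 := by
        rw [← hout]
        exact hws _ (by rw [hin]; exact List.Forall₂.cons hmem List.Forall₂.nil)
      have htake : xs.take t.inSorts.length = xs := by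
        rw [← hxs'.length_eq, List.take_length]
      simp only [applyChunks, htake]
      rw [hkfn xs hxs', hπ0 _ hval, hπ1 _ hmem]

end HetRamsey

open HetRamsey

/-- let `(A 0, A 1, 𝓖₀ ∪ 𝓖₁ ∪ {h})` be a two-phylum algebra where
`𝓖₀` and `𝓖₁` have the same signature and `h` is a homomorphism from `(A 1, 𝓖₁)`
into `(A 0, 𝓖₀)`. If `(A 0, 𝓖₀)` is not a Ramsey algebra, witnessed by some
`β⃗ ∈ ^ω(im h)` and `X ⊆ A 0`, then the algebra is not `e`-Ramsey for any
`e ∈ Ω₀`. -/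
theorem not_eRamsey_of_scalarPart_not_ramsey_witnessed_in_image
    {U : Type v}
    (A : Fin 2 → Set U) (G0 G1 : Set (HetOp (Fin 2) U)) (hOp : HetOp (Fin 2) U)
    (hne : ∀ ξ, (A ξ).Nonempty)
    (hdisj : Pairwise fun ξ η => Disjoint (A ξ) (A η))
    (hG0 : ∀ f ∈ G0, f.outSort = 0 ∧ (∀ ξ ∈ f.inSorts, ξ = 0) ∧ WellSorted A f)
    (hG1 : ∀ f ∈ G1, f.outSort = 1 ∧ (∀ ξ ∈ f.inSorts, ξ = 1) ∧ WellSorted A f)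
    (hin : hOp.inSorts = [1]) (hout : hOp.outSort = 0) (hws : WellSorted A hOp)
    -- `𝓖₀` and `𝓖₁` have the same signature, via the arity-preserving bijection `T`
    (T : HetOp (Fin 2) U → HetOp (Fin 2) U)
    (hT : Set.BijOn T G1 G0)
    (hTarity : ∀ F ∈ G1, (T F).inSorts.length = F.inSorts.length)
    -- `h` is a homomorphism from `(A 1, 𝓖₁)` into `(A 0, 𝓖₀)`
    (hhom : ∀ F ∈ G1, ∀ xs : List U,
        List.Forall₂ (fun x ξ => x ∈ A ξ) xs F.inSorts →
        hOp.fn [F.fn xs] = (T F).fn (xs.map fun x => hOp.fn [x]))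
    -- `β⃗ ∈ ^ω(im h)` and `X` witness that `(A 0, 𝓖₀)` is not a Ramsey algebra
    (β : ℕ → U) (hβ : ∀ i, β i ∈ (fun x => hOp.fn [x]) '' A 1)
    (X : Set U) (hX : X ⊆ A 0)
    (hwit : ∀ u : ℕ → U, Reduction A G0 u β → (∀ i, u i ∈ A 0) →
        ¬(FRfin A G0 u ⊆ X ∨ FRfin A G0 u ∩ X = ∅))
    (e : ℕ → Fin 2) (he : InOmega e) (he0 : e 0 = 0) :
    ¬ IsERamsey A (G0 ∪ G1 ∪ {hOp}) e := by
  classical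
  intro hR
  obtain ⟨d, -⟩ := hne 0
  choose γ hγ hγβ using hβ
  replace hγβ : ∀ i, hOp.fn [γ i] = β i := hγβ
  have hh : ∀ x ∈ A 1, hOp.fn [x] ∈ A 0 := fun x hx => by
    rw [← hout]
    exact hws _ (by rw [hin]; exact List.Forall₂.cons hx List.Forall₂.nil)
  have hβ0 : ∀ i, β i ∈ A 0 := fun i => hγβ i ▸ hh _ (hγ i)
  have hd : ∀ {ξ η : Fin 2} {x : U}, x ∈ A ξ → x ∈ A η → ξ = η := fun {ξ η x} h1 h2 =>
    by_contra fun hn => Set.disjoint_left.1 (hdisj hn) h1 h2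
  obtain ⟨π, hπ0, hπ1⟩ : ∃ π : U → U, (∀ x ∈ A 0, π x = x) ∧ ∀ x ∈ A 1, π x = hOp.fn [x] :=
    ⟨fun x => if x ∈ A 1 then hOp.fn [x] else x,
      fun x hx => if_neg fun h1 => absurd (hd hx h1) (by decide), fun x hx => if_pos hx⟩
  have hπA : ∀ ξ : Fin 2, ∀ x ∈ A ξ, π x ∈ A 0 := by
    intro ξ x hx
    fin_cases ξ
    · exact (hπ0 x hx).symm ▸ hx
    · exact (hπ1 x hx).symm ▸ hh x hx
  let b : ℕ → U := fun i => if e i = 0 then β i else γ i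
  have hb : Sorted A e b := by
    intro i
    by_cases h0 : e i = 0
    · simpa [b, h0] using hβ0 i
    · have h1 : e i = 1 := by omega
      simpa [b, h1] using hγ i
  have hπb : ∀ i, π (b i) = β i := by
    intro i
    by_cases h0 : e i = 0
    · simpa [b, h0] using hπ0 _ (hβ0 i)
    · simpa [b, h0, hγβ] using hπ1 _ (hγ i)
  obtain ⟨a, ⟨φ, f, hf, hφ, hφlt, hφs, haf⟩, haS, hdec⟩ := hR b hb X (he0.symm ▸ hX)
  choose k hk hkin hkout hkfn using fun j =>
    (hf j).exists_projection d hG0 hG1 hin hout hws hT.mapsTo hTarity hhom hπ0 hπ1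
  have huA : ∀ i, π (a i) ∈ A 0 := fun i => hπA _ _ (haS i)
  have hred : Reduction A G0 (fun i => π (a i)) β := by
    refine ⟨φ, k, hk, hφ, hφlt, fun j => ?_, fun j => ?_⟩
    · rw [hkin, List.forall₂_map_right_iff]
      exact (hφs j).imp fun i _ _ => hβ0 i
    · have := hkfn j ((φ j).map b) (List.forall₂_map_left_iff.2 (hφs j))
      rw [List.map_map] at this
      change π (a j) = _
      rw [haf j, ← this]
      exact congrArg (k j).fn (List.map_congr_left fun i _ => hπb i)
  let leaf : Fin 2 → HetOp (Fin 2) U := fun ξ => if ξ = 0 then idOp d 0 else hOp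
  have hsub : FRfin A G0 (fun i => π (a i)) ⊆ FR A (G0 ∪ G1 ∪ {hOp}) e a := by
    rintro _ ⟨g, ns, hg, hns, hsort, rfl⟩
    have hgin : ∀ ξ ∈ g.inSorts, ξ = 0 := by
      intro ξ hξ
      obtain ⟨n, hn, hlt⟩ := List.getElem_of_mem hξ
      have := hsort.get (i := n) (by rw [hsort.length_eq]; exact hn) hn
      simp only [List.get_eq_getElem, hlt] at this
      exact hd this (huA _)
    have hgout : g.outSort = 0 := by
      cases hg with
      | base h => exact (hG0 _ h).1
      | id ξ _ h1 h2 _ => rw [h2]; exact hgin ξ (by rw [h1]; simp)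
      | comp g' _ h _ _ => exact (hG0 g' h).1
    obtain ⟨t, ht, htin, htout, htfn⟩ := hg.exists_comp_leaf (A := A)
      (F := G0 ∪ G1 ∪ {hOp}) π leaf
      (fun ξ => by fin_cases ξ; exacts [OT.of_idOp _ _ _, OT.base (Or.inr rfl)])
      (fun ξ => by fin_cases ξ; exacts [rfl, hin])
      (fun ξ => by fin_cases ξ; exacts [rfl, hout])
      (fun ξ => by
        fin_cases ξ
        exacts [fun x hx => (hπ0 x hx).symm, fun x hx => (hπ1 x hx).symm])
      (fun _ h => Or.inl (Or.inl h)) (fun f hf => (hG0 f hf).2.1) hgin (ns.map e)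
      (by rw [List.length_map, hsort.length_eq])
    have hnsS : List.Forall₂ (fun i ξ => a i ∈ A ξ) ns (ns.map e) := by
      rw [List.forall₂_map_right_iff, List.forall₂_same]
      exact fun i _ => haS i
    have hval := htfn (ns.map a) (List.forall₂_map_left_iff.2 hnsS)
    rw [List.map_map] at hval
    change g.fn (ns.map (π ∘ a)) ∈ _
    rw [← hval]
    refine mem_FR_of_OT he haS ht hns (htin.symm ▸ hnsS) ?_
    rw [hval, he0, ← hgout]
    exact hg.wellSorted (fun f hf => (hG0 f hf).2.2) _ (List.forall₂_map_left_iff.2 hsort)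
  refine hwit _ hred huA (hdec.imp hsub.trans fun h => ?_)
  exact Set.subset_empty_iff.1 (h ▸ Set.inter_subset_inter_left X hsub)
end

section
/- For each positive integer n, neither (M_n(𝔽), 𝔽, +_𝔽, ×_𝔽, |·|) nor (M_n(𝔽), 𝔽, ×, +_𝔽, ×_𝔽, |·|) is an e⃗-Ramsey algebra for any e⃗ ∈ Ω_0. -/
universe u v

namespace HetRamsey

/-- The underlying universe of a matrix algebra: scalars (left) and matrices (right). -/
abbrev MatU (𝔽 : Type) (n : ℕ) : Type := 𝔽 ⊕ Matrix (Fin n) (Fin n) 𝔽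

/-- The two phyla: index `0` is the scalar phylum `𝔽`, index `1` the matrix phylum. -/
def matPhyla (𝔽 : Type) (n : ℕ) : Fin 2 → Set (MatU 𝔽 n) :=
  fun i => if i = 0 then Set.range Sum.inl else Set.range Sum.inr

def toScal {𝔽 : Type} [Zero 𝔽] {n : ℕ} : MatU 𝔽 n → 𝔽
  | Sum.inl r => r
  | Sum.inr _ => 0

def toMat {𝔽 : Type} [Zero 𝔽] {n : ℕ} : MatU 𝔽 n → Matrix (Fin n) (Fin n) 𝔽
  | Sum.inl _ => 0
  | Sum.inr m => m

/-- Matrix addition as a heterogeneous operation. -/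
def matAddOp (𝔽 : Type) [Field 𝔽] (n : ℕ) : HetOp (Fin 2) (MatU 𝔽 n) :=
  ⟨[1, 1], 1, fun xs => match xs with
    | [x, y] => Sum.inr (toMat x + toMat y)
    | _ => Sum.inl 0⟩

/-- Matrix multiplication as a heterogeneous operation. -/
def matMulOp (𝔽 : Type) [Field 𝔽] (n : ℕ) : HetOp (Fin 2) (MatU 𝔽 n) :=
  ⟨[1, 1], 1, fun xs => match xs with
    | [x, y] => Sum.inr (toMat x * toMat y)
    | _ => Sum.inl 0⟩

/-- Field addition as a heterogeneous operation. -/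
def scalAddOp (𝔽 : Type) [Field 𝔽] (n : ℕ) : HetOp (Fin 2) (MatU 𝔽 n) :=
  ⟨[0, 0], 0, fun xs => match xs with
    | [x, y] => Sum.inl (toScal x + toScal y)
    | _ => Sum.inl 0⟩

/-- Field multiplication as a heterogeneous operation. -/
def scalMulOp (𝔽 : Type) [Field 𝔽] (n : ℕ) : HetOp (Fin 2) (MatU 𝔽 n) :=
  ⟨[0, 0], 0, fun xs => match xs with
    | [x, y] => Sum.inl (toScal x * toScal y)
    | _ => Sum.inl 0⟩

/-- The determinant as a heterogeneous operation from the matrix phylum to the scalar phylum. -/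
def detOp (𝔽 : Type) [Field 𝔽] (n : ℕ) : HetOp (Fin 2) (MatU 𝔽 n) :=
  ⟨[1], 0, fun xs => match xs with
    | [x] => Sum.inl (toMat x).det
    | _ => Sum.inl 0⟩

end HetRamsey

namespace HetRamsey

/-- The number whose binary digits record the family `C`, each `S ∈ C` being coded by the
monomial `∏ i ∈ S, 2 ^ 2 ^ i`. -/
def famVal (C : Finset (Finset ℕ)) : ℕ := ∑ S ∈ C, 2 ^ ∑ i ∈ S, 2 ^ i

/-- `C` is a nonempty family of nonempty subsets of `s`. -/
def IsFam (s : Finset ℕ) (C : Finset (Finset ℕ)) : Prop :=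
  C.Nonempty ∧ ∀ S ∈ C, S.Nonempty ∧ S ⊆ s

lemma famVal_injective : Function.Injective famVal := by
  intro C D h
  have hg : Function.Injective fun S : Finset ℕ => ∑ i ∈ S, 2 ^ i :=
    Finset.geomSum_injective le_rfl
  have key : ∀ E : Finset (Finset ℕ),
      famVal E = ∑ k ∈ E.image (fun S => ∑ i ∈ S, 2 ^ i), 2 ^ k := fun E => by
    rw [Finset.sum_image fun _ _ _ _ h => hg h, famVal]
  rw [key, key] at h
  exact Finset.image_injective hg (Finset.geomSum_injective (n := 2) le_rfl h)

lemma IsFam.disjoint {s t : Finset ℕ} {C D : Finset (Finset ℕ)} (hst : Disjoint s t)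
    (hC : IsFam s C) (hD : IsFam t D) : Disjoint C D := by
  rw [Finset.disjoint_left]
  intro S hSC hSD
  obtain ⟨⟨i, hi⟩, hSs⟩ := hC.2 S hSC
  exact Finset.disjoint_left.1 hst (hSs hi) ((hD.2 S hSD).2 hi)

lemma IsFam.famVal_union {s t : Finset ℕ} {C D : Finset (Finset ℕ)} (hst : Disjoint s t)
    (hC : IsFam s C) (hD : IsFam t D) : famVal (C ∪ D) = famVal C + famVal D :=
  Finset.sum_union (hC.disjoint hst hD)

lemma IsFam.famVal_image₂ {s t : Finset ℕ} {C D : Finset (Finset ℕ)} (hst : Disjoint s t)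
    (hC : IsFam s C) (hD : IsFam t D) :
    famVal (Finset.image₂ (· ∪ ·) C D) = famVal C * famVal D := by
  rw [famVal, famVal, famVal, Finset.sum_mul_sum, ← Finset.sum_product', Finset.image₂,
    Finset.sum_image]
  · refine Finset.sum_congr rfl fun p hp => ?_
    rw [Finset.mem_product] at hp
    rw [← pow_add]
    congr 1
    exact Finset.sum_union (hst.mono (hC.2 _ hp.1).2 (hD.2 _ hp.2).2)
  · rintro ⟨S, T⟩ hp ⟨S', T'⟩ hp' h
    simp only [Finset.coe_product, Set.mem_prod, Finset.mem_coe] at hp hp'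
    simp only [Function.uncurry_apply_pair] at h
    have h1 := (hC.2 _ hp.1).2
    have h2 := (hD.2 _ hp.2).2
    have h3 := (hC.2 _ hp'.1).2
    have h4 := (hD.2 _ hp'.2).2
    rw [Finset.disjoint_left] at hst
    rw [Prod.mk.injEq]
    constructor
    · ext i
      have := congrArg (i ∈ ·) h
      simp only [Finset.mem_union, eq_iff_iff] at this
      have := @h1 i; have := @h2 i; have := @h3 i; have := @h4 i; have := @hst i
      tauto
    · ext i
      have := congrArg (i ∈ ·) h
      simp only [Finset.mem_union, eq_iff_iff] at this
      have := @h1 i; have := @h2 i; have := @h3 i; have := @h4 i; have := @hst i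
      tauto

lemma IsFam.union {s t : Finset ℕ} {C D : Finset (Finset ℕ)}
    (hC : IsFam s C) (hD : IsFam t D) : IsFam (s ∪ t) (C ∪ D) := by
  refine ⟨hC.1.mono Finset.subset_union_left, fun S hS => ?_⟩
  rcases Finset.mem_union.1 hS with h | h
  · exact ⟨(hC.2 S h).1, (hC.2 S h).2.trans Finset.subset_union_left⟩
  · exact ⟨(hD.2 S h).1, (hD.2 S h).2.trans Finset.subset_union_right⟩

lemma IsFam.image₂ {s t : Finset ℕ} {C D : Finset (Finset ℕ)}
    (hC : IsFam s C) (hD : IsFam t D) : IsFam (s ∪ t) (Finset.image₂ (· ∪ ·) C D) := by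
  refine ⟨hC.1.image₂ hD.1, fun R hR => ?_⟩
  obtain ⟨S, hS, T, hT, rfl⟩ := Finset.mem_image₂.1 hR
  exact ⟨(hC.2 S hS).1.mono Finset.subset_union_left,
    Finset.union_subset_union (hC.2 S hS).2 (hD.2 T hT).2⟩

/-- No family is both a sum and a product of families with disjoint supports. -/
lemma IsFam.union_ne_image₂ {s t s' t' : Finset ℕ} {A B C D : Finset (Finset ℕ)}
    (hst : Disjoint s t) (hA : IsFam s A) (hB : IsFam t B)
    (hC : IsFam s' C) (hD : IsFam t' D) : A ∪ B ≠ Finset.image₂ (· ∪ ·) C D := by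
  intro h
  obtain ⟨S, hS⟩ := hA.1
  obtain ⟨T, hT⟩ := hB.1
  obtain ⟨S₁, hS₁, S₂, hS₂, rfl⟩ := Finset.mem_image₂.1 (h ▸ Finset.mem_union_left B hS)
  obtain ⟨T₁, hT₁, T₂, hT₂, rfl⟩ := Finset.mem_image₂.1 (h ▸ Finset.mem_union_right A hT)
  have hmem : S₁ ∪ T₂ ∈ A ∪ B := h ▸ Finset.mem_image₂_of_mem hS₁ hT₂
  rw [Finset.disjoint_left] at hst
  rcases Finset.mem_union.1 hmem with hm | hm
  · obtain ⟨i, hi⟩ := (hD.2 _ hT₂).1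
    exact hst ((hA.2 _ hm).2 (Finset.mem_union_right _ hi))
      ((hB.2 _ hT).2 (Finset.mem_union_right _ hi))
  · obtain ⟨i, hi⟩ := (hC.2 _ hS₁).1
    exact hst ((hA.2 _ hS).2 (Finset.mem_union_left _ hi))
      ((hB.2 _ hm).2 (Finset.mem_union_left _ hi))

/-- `x` is the value of a family supported in `s`. -/
def IsFamVal {𝔽 : Type} [Field 𝔽] (s : Finset ℕ) (x : 𝔽) : Prop :=
  ∃ C, IsFam s C ∧ x = (famVal C : 𝔽)

lemma IsFamVal.add {𝔽 : Type} [Field 𝔽] {s t : Finset ℕ} {x y : 𝔽} (hst : Disjoint s t)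
    (hx : IsFamVal s x) (hy : IsFamVal t y) : IsFamVal (s ∪ t) (x + y) := by
  obtain ⟨C, hC, rfl⟩ := hx
  obtain ⟨D, hD, rfl⟩ := hy
  exact ⟨C ∪ D, hC.union hD, by rw [hC.famVal_union hst hD, Nat.cast_add]⟩

lemma IsFamVal.mul {𝔽 : Type} [Field 𝔽] {s t : Finset ℕ} {x y : 𝔽} (hst : Disjoint s t)
    (hx : IsFamVal s x) (hy : IsFamVal t y) : IsFamVal (s ∪ t) (x * y) := by
  obtain ⟨C, hC, rfl⟩ := hx
  obtain ⟨D, hD, rfl⟩ := hy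
  exact ⟨_, hC.image₂ hD, by rw [hC.famVal_image₂ hst hD, Nat.cast_mul]⟩

lemma IsFamVal.add_ne_mul {𝔽 : Type} [Field 𝔽] [CharZero 𝔽] {s t s' t' : Finset ℕ}
    {x y z w : 𝔽} (hst : Disjoint s t) (hst' : Disjoint s' t')
    (hx : IsFamVal s x) (hy : IsFamVal t y) (hz : IsFamVal s' z) (hw : IsFamVal t' w) :
    x + y ≠ z * w := by
  obtain ⟨A, hA, rfl⟩ := hx
  obtain ⟨B, hB, rfl⟩ := hy
  obtain ⟨C, hC, rfl⟩ := hz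
  obtain ⟨D, hD, rfl⟩ := hw
  intro h
  rw [← Nat.cast_add, ← Nat.cast_mul, Nat.cast_inj, ← hA.famVal_union hst hB,
    ← hC.famVal_image₂ hst' hD] at h
  exact hA.union_ne_image₂ hst hB hC hD (famVal_injective h)

lemma isFamVal_singleton {𝔽 : Type} [Field 𝔽] (i : ℕ) :
    IsFamVal {i} ((2 : 𝔽) ^ 2 ^ i) :=
  ⟨{{i}}, by simp [IsFam], by simp [famVal]⟩

/-- A scalar itself, or the determinant of a matrix. -/
def scalOrDet {𝔽 : Type} [Field 𝔽] {n : ℕ} : MatU 𝔽 n → 𝔽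
  | Sum.inl r => r
  | Sum.inr m => m.det

lemma mem_matPhyla_zero {𝔽 : Type} {n : ℕ} {x : MatU 𝔽 n} :
    x ∈ matPhyla 𝔽 n 0 ↔ ∃ r, Sum.inl r = x := by
  simp [matPhyla]

lemma mem_matPhyla_one {𝔽 : Type} {n : ℕ} {x : MatU 𝔽 n} :
    x ∈ matPhyla 𝔽 n 1 ↔ ∃ m, Sum.inr m = x := by
  simp [matPhyla]

/-- `x` lies in the phylum of index `ξ`, and its scalar or determinant is the value of a family
supported in `s`. -/
def FamElem (𝔽 : Type) [Field 𝔽] (n : ℕ) (s : Finset ℕ) (ξ : Fin 2) (x : MatU 𝔽 n) : Prop :=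
  x ∈ matPhyla 𝔽 n ξ ∧ IsFamVal s (scalOrDet x)

lemma FamElem.fn_pair {𝔽 : Type} [Field 𝔽] {n : ℕ} {g : HetOp (Fin 2) (MatU 𝔽 n)}
    (hg : g = matMulOp 𝔽 n ∨ g = scalAddOp 𝔽 n ∨ g = scalMulOp 𝔽 n)
    {s t : Finset ℕ} (hst : Disjoint s t) {ξ η : Fin 2} (hin : g.inSorts = [ξ, η])
    {x y : MatU 𝔽 n} (hx : FamElem 𝔽 n s ξ x) (hy : FamElem 𝔽 n t η y) :
    FamElem 𝔽 n (s ∪ t) g.outSort (g.fn [x, y]) := by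
  obtain ⟨hxA, hx⟩ := hx
  obtain ⟨hyA, hy⟩ := hy
  rcases hg with rfl | rfl | rfl
  · obtain ⟨rfl, rfl⟩ : 1 = ξ ∧ 1 = η := by simpa [matMulOp] using hin
    obtain ⟨x, rfl⟩ := mem_matPhyla_one.1 hxA
    obtain ⟨y, rfl⟩ := mem_matPhyla_one.1 hyA
    refine ⟨mem_matPhyla_one.2 ⟨_, rfl⟩, ?_⟩
    have h := hx.mul hst hy
    simpa [scalOrDet, matMulOp, toMat, Matrix.det_mul] using h
  · obtain ⟨rfl, rfl⟩ : 0 = ξ ∧ 0 = η := by simpa [scalAddOp] using hin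
    obtain ⟨x, rfl⟩ := mem_matPhyla_zero.1 hxA
    obtain ⟨y, rfl⟩ := mem_matPhyla_zero.1 hyA
    exact ⟨mem_matPhyla_zero.2 ⟨_, rfl⟩, hx.add hst hy⟩
  · obtain ⟨rfl, rfl⟩ : 0 = ξ ∧ 0 = η := by simpa [scalMulOp] using hin
    obtain ⟨x, rfl⟩ := mem_matPhyla_zero.1 hxA
    obtain ⟨y, rfl⟩ := mem_matPhyla_zero.1 hyA
    exact ⟨mem_matPhyla_zero.2 ⟨_, rfl⟩, hx.mul hst hy⟩

lemma FamElem.det {𝔽 : Type} [Field 𝔽] {n : ℕ} {s : Finset ℕ} {x : MatU 𝔽 n}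
    (hx : FamElem 𝔽 n s 1 x) : FamElem 𝔽 n s 0 ((detOp 𝔽 n).fn [x]) := by
  obtain ⟨hxA, hx⟩ := hx
  obtain ⟨x, rfl⟩ := mem_matPhyla_one.1 hxA
  exact ⟨mem_matPhyla_zero.2 ⟨_, rfl⟩, hx⟩

lemma exists_inSorts_eq_pair {𝔽 : Type} [Field 𝔽] {n : ℕ} {g : HetOp (Fin 2) (MatU 𝔽 n)}
    (hg : g = matMulOp 𝔽 n ∨ g = scalAddOp 𝔽 n ∨ g = scalMulOp 𝔽 n) :
    ∃ ξ η, g.inSorts = [ξ, η] := by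
  rcases hg with rfl | rfl | rfl
  exacts [⟨_, _, rfl⟩, ⟨_, _, rfl⟩, ⟨_, _, rfl⟩]

/-- Orderly terms applied to values of families with disjoint supports give values of families. -/
lemma OT.famElem {𝔽 : Type} [Field 𝔽] {n : ℕ} {F : Set (HetOp (Fin 2) (MatU 𝔽 n))}
    (hF : F ⊆ {matMulOp 𝔽 n, scalAddOp 𝔽 n, scalMulOp 𝔽 n, detOp 𝔽 n})
    {b : ℕ → MatU 𝔽 n} (hb : ∀ i, IsFamVal {i} (scalOrDet (b i)))
    {f : HetOp (Fin 2) (MatU 𝔽 n)} (hf : OT F f) :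
    ∀ ns : List ℕ, ns.Nodup → List.Forall₂ (fun i ξ => b i ∈ matPhyla 𝔽 n ξ) ns f.inSorts →
      FamElem 𝔽 n ns.toFinset f.outSort (f.fn (ns.map b)) := by
  have cases_mem : ∀ g ∈ F, (g = matMulOp 𝔽 n ∨ g = scalAddOp 𝔽 n ∨ g = scalMulOp 𝔽 n) ∨
      g = detOp 𝔽 n := fun g hg => by
    have := hF hg
    simp only [Set.mem_insert_iff, Set.mem_singleton_iff] at this
    tauto
  induction hf with
  | base hg =>
    intro ns hnd hs
    rcases cases_mem _ hg with h | rfl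
    · obtain ⟨ξ, η, hin⟩ := exists_inSorts_eq_pair h
      rw [hin] at hs
      obtain _ | ⟨hi, _ | ⟨hj, _ | _⟩⟩ := hs
      simp only [List.nodup_cons, List.mem_singleton] at hnd
      have := FamElem.fn_pair h (Finset.disjoint_singleton.2 hnd.1) hin ⟨hi, hb _⟩ ⟨hj, hb _⟩
      simpa using this
    · obtain _ | ⟨hi, _ | _⟩ := hs
      exact FamElem.det ⟨hi, hb _⟩
  | id ξ c hin hout hfn =>
    intro ns _ hs
    rw [hin] at hs
    obtain _ | ⟨hi, _ | _⟩ := hs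
    rw [hout, List.map_singleton, hfn]
    exact ⟨hi, hb _⟩
  | comp g hs hg _hOT hout ih =>
    intro ns hnd hsort
    rcases cases_mem _ hg with h | rfl
    · obtain ⟨ξ, η, hin⟩ := exists_inSorts_eq_pair h
      rw [hin] at hout
      obtain _ | ⟨rfl, _ | ⟨rfl, _ | _⟩⟩ := hout
      rename_i h₁ h₂
      simp only [List.map_cons, List.map_nil, List.flatten_cons, List.flatten_nil,
        List.append_nil] at hsort
      obtain ⟨l₁, l₂, hl₁, hl₂, rfl⟩ : ∃ l₁ l₂,
          List.Forall₂ (fun i ξ => b i ∈ matPhyla 𝔽 n ξ) l₁ h₁.inSorts ∧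
          List.Forall₂ (fun i ξ => b i ∈ matPhyla 𝔽 n ξ) l₂ h₂.inSorts ∧ ns = l₁ ++ l₂ :=
        ⟨_, _, List.forall₂_take_append _ _ _ hsort, List.forall₂_drop_append _ _ _ hsort,
          (List.take_append_drop _ _).symm⟩
      rw [List.nodup_append] at hnd
      have key := FamElem.fn_pair h (s := l₁.toFinset) (t := l₂.toFinset)
        (Finset.disjoint_left.2 fun i hi hj =>
          hnd.2.2 i (List.mem_toFinset.1 hi) i (List.mem_toFinset.1 hj) rfl) hin
        (ih h₁ (by simp) l₁ hnd.1 hl₁) (ih h₂ (by simp) l₂ hnd.2.1 hl₂)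
      have e₁ : h₁.inSorts.length = (l₁.map b).length := by
        rw [List.length_map, hl₁.length_eq]
      have e₂ : h₂.inSorts.length = (l₂.map b).length := by
        rw [List.length_map, hl₂.length_eq]
      simp only [applyChunks, List.map_append, List.toFinset_append]
      rw [e₁, List.take_left, List.drop_left, e₂, List.take_length]
      exact key
    · obtain _ | ⟨h1, _ | _⟩ := hout
      rename_i h₁
      simp only [List.map_cons, List.map_nil, List.flatten_cons, List.flatten_nil,
        List.append_nil] at hsort
      have key := ih h₁ (by simp) ns hnd hsort
      have e₁ : h₁.inSorts.length = (ns.map b).length := by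
        rw [List.length_map, hsort.length_eq]
      rw [h1] at key
      simp only [applyChunks]
      rw [e₁, List.take_length]
      exact key.det

/-- In an `e`-sorted sequence, a binary operation applied to the first term and a later term
gives the first term of an `e`-sorted reduction. -/
lemma fn_pair_mem_FR {I U : Type*} [Nonempty U] {A : I → Set U} {F : Set (HetOp I U)}
    {e : ℕ → I} (he : InOmega e) {a : ℕ → U} (ha : Sorted A e a) {g : HetOp I U} (hg : g ∈ F)
    {j : ℕ} (hj : 0 < j) (hin : g.inSorts = [e 0, e j])
    (hmem : g.fn [a 0, a j] ∈ A (e 0)) : g.fn [a 0, a j] ∈ FR A F e a := by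
  have hpick : ∀ i N, ∃ m, N < m ∧ e m = e i := fun i N => by
    obtain ⟨m, hm, hN⟩ := (he i).exists_gt N
    exact ⟨m, hN, hm⟩
  choose pick hlt hpe using hpick
  let ψ : ℕ → ℕ := fun k => Nat.rec j (fun i m => pick (i + 1) m) k
  have hψ : StrictMono ψ := strictMono_nat_of_lt_succ fun i => hlt (i + 1) (ψ i)
  have hψe : ∀ i, e (ψ (i + 1)) = e (i + 1) := fun i => hpe (i + 1) (ψ i)
  have u : U := Classical.arbitrary U
  refine ⟨fun k => Nat.casesOn k (g.fn [a 0, a j]) fun i => a (ψ (i + 1)),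
    ⟨fun k => Nat.casesOn k [0, j] fun i => [ψ (i + 1)],
      fun k => Nat.casesOn k g fun i => ⟨[e (i + 1)], e (i + 1), fun l => l.headD u⟩,
      ?_, ?_, ?_, ?_, ?_⟩, ?_, rfl⟩
  · rintro (_ | i)
    · exact OT.base hg
    · exact OT.id (e (i + 1)) _ rfl rfl fun _ => rfl
  · rintro (_ | i)
    · exact List.isChain_pair.2 hj
    · exact List.isChain_singleton _
  · rintro (_ | i) (_ | k) hik x hx y hy
    · exact absurd hik (lt_irrefl _)
    · change x ∈ [0, j] at hx
      change y ∈ [ψ (k + 1)] at hy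
      simp only [List.mem_cons, List.not_mem_nil, or_false] at hx hy
      have hjk : j < ψ (k + 1) := hψ (Nat.succ_pos k)
      rw [hy]
      rcases hx with rfl | rfl
      exacts [hj.trans hjk, hjk]
    · exact absurd hik (Nat.not_lt_zero _)
    · simp only [List.mem_cons, List.not_mem_nil, or_false] at hx hy
      rw [hx, hy]
      exact hψ hik
  · rintro (_ | i)
    · change List.Forall₂ _ [0, j] g.inSorts
      rw [hin]
      exact .cons (ha 0) (.cons (ha j) .nil)
    · refine .cons ?_ .nil
      rw [← hψe i]
      exact ha _
  · rintro (_ | i) <;> rfl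
  · rintro (_ | i)
    · exact hmem
    · change a (ψ (i + 1)) ∈ A (e (i + 1))
      rw [← hψe i]
      exact ha _

lemma exists_sorted_isFamVal (𝔽 : Type) [Field 𝔽] {n : ℕ} (hn : 0 < n) (e : ℕ → Fin 2) :
    ∃ b : ℕ → MatU 𝔽 n, Sorted (matPhyla 𝔽 n) e b ∧ ∀ i, IsFamVal {i} (scalOrDet (b i)) := by
  have h : ∀ i, ∃ x, x ∈ matPhyla 𝔽 n (e i) ∧ IsFamVal {i} (scalOrDet x) := fun i => by
    rcases Fin.exists_fin_two.1 ⟨e i, rfl⟩ with h | h <;> rw [h]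
    · exact ⟨Sum.inl (2 ^ 2 ^ i), mem_matPhyla_zero.2 ⟨_, rfl⟩, isFamVal_singleton i⟩
    · refine ⟨Sum.inr (Matrix.diagonal (Function.update 1 ⟨0, hn⟩ (2 ^ 2 ^ i))),
        mem_matPhyla_one.2 ⟨_, rfl⟩, ?_⟩
      have hdet : (Matrix.diagonal (Function.update (1 : Fin n → 𝔽) ⟨0, hn⟩ (2 ^ 2 ^ i))).det =
          2 ^ 2 ^ i := by
        simp [Matrix.det_diagonal, Finset.prod_update_of_mem]
      simpa only [scalOrDet, hdet] using isFamVal_singleton (𝔽 := 𝔽) i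
  choose b hb using h
  exact ⟨b, fun i => (hb i).1, fun i => (hb i).2⟩

lemma not_isERamsey_of_subset {𝔽 : Type} [Field 𝔽] [CharZero 𝔽] {n : ℕ} (hn : 0 < n)
    {F : Set (HetOp (Fin 2) (MatU 𝔽 n))}
    (hF : F ⊆ {matMulOp 𝔽 n, scalAddOp 𝔽 n, scalMulOp 𝔽 n, detOp 𝔽 n})
    (hadd : scalAddOp 𝔽 n ∈ F) (hmul : scalMulOp 𝔽 n ∈ F)
    {e : ℕ → Fin 2} (he : InOmega e) (he0 : e 0 = 0) : ¬ IsERamsey (matPhyla 𝔽 n) F e := by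
  intro hR
  obtain ⟨b, hbs, hb⟩ := exists_sorted_isFamVal 𝔽 hn e
  obtain ⟨a, ⟨φ, f, hOT, hchain, hlt, hsort, haf⟩, has, hX⟩ := hR b hbs
    {x | ∃ s t : Finset ℕ, Disjoint s t ∧ ∃ y z : 𝔽, IsFamVal s y ∧ IsFamVal t z ∧
      Sum.inl (y + z) = x} (by
        rintro _ ⟨_, _, _, y, z, _, _, rfl⟩
        rw [he0]
        exact mem_matPhyla_zero.2 ⟨_, rfl⟩)
  have hval : ∀ k, IsFamVal (φ k).toFinset (scalOrDet (a k)) := fun k => by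
    rw [haf k]
    exact ((hOT k).famElem hF hb (φ k)
      ((List.isChain_iff_pairwise.1 (hchain k)).imp fun h => ne_of_lt h) (hsort k)).2
  obtain ⟨j, hej, hj⟩ := (he 0).exists_gt 0
  have hej : e j = 0 := he0 ▸ hej
  have hdisj : Disjoint (φ 0).toFinset (φ j).toFinset := Finset.disjoint_left.2 fun i hi hi' =>
    lt_irrefl i (hlt 0 j hj i (List.mem_toFinset.1 hi) i (List.mem_toFinset.1 hi'))
  have h0 := hval 0
  have h1 := hval j
  obtain ⟨y, hy⟩ := mem_matPhyla_zero.1 (he0 ▸ has 0)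
  obtain ⟨z, hz⟩ := mem_matPhyla_zero.1 (hej ▸ has j)
  rw [← hy] at h0
  rw [← hz] at h1
  have hsum : Sum.inl (y + z) ∈ FR (matPhyla 𝔽 n) F e a := by
    have := fn_pair_mem_FR he has hadd hj (by rw [he0, hej]; rfl)
      (by rw [he0]; exact mem_matPhyla_zero.2 ⟨_, rfl⟩)
    rwa [← hy, ← hz] at this
  have hprod : Sum.inl (y * z) ∈ FR (matPhyla 𝔽 n) F e a := by
    have := fn_pair_mem_FR he has hmul hj (by rw [he0, hej]; rfl)
      (by rw [he0]; exact mem_matPhyla_zero.2 ⟨_, rfl⟩)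
    rwa [← hy, ← hz] at this
  rcases hX with hX | hX
  · obtain ⟨s, t, hst, y', z', hy', hz', h⟩ := hX hprod
    exact hy'.add_ne_mul hst hdisj hz' h0 h1 (Sum.inl_injective h)
  · exact (Set.eq_empty_iff_forall_notMem.1 hX _)
      ⟨hsum, _, _, hdisj, y, z, h0, h1, rfl⟩

end HetRamsey

open HetRamsey

/-- for `e ∈ Ω₀`, neither `(Mₙ(𝔽), 𝔽, +_𝔽, ×_𝔽, |·|)` nor
`(Mₙ(𝔽), 𝔽, ×, +_𝔽, ×_𝔽, |·|)` is an `e`-Ramsey algebra. -/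
theorem scalarField_det_reducts_not_eRamsey
    (𝔽 : Type) [Field 𝔽] [CharZero 𝔽] (n : ℕ) (hn : 0 < n)
    (e : ℕ → Fin 2) (he : InOmega e) (he0 : e 0 = 0) :
    ¬ IsERamsey (matPhyla 𝔽 n) {scalAddOp 𝔽 n, scalMulOp 𝔽 n, detOp 𝔽 n} e ∧
    ¬ IsERamsey (matPhyla 𝔽 n) {matMulOp 𝔽 n, scalAddOp 𝔽 n, scalMulOp 𝔽 n, detOp 𝔽 n} e := by
  exact ⟨not_isERamsey_of_subset hn (Set.subset_insert _ _) (by simp) (by simp) he he0,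
    not_isERamsey_of_subset hn subset_rfl (by simp) (by simp) he he0⟩
end
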